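/- arXiv:2006.11701 — 2 statements merged into one kernel-verified Lean document; each statement's English description precedes it below -/
import Mathlib

section
/- Let p be a prime and let r, s be integers with 0 ≤ s ≤ r ≤ p-1. The congruence C(p·a + r, p·b + s) ≡ C(a,b)·C(r,s) (mod p²) holds for all integers a ≥ 0 and b ≥ 0 if and only if H_r ≡ H_{r-s} ≡ H_s (mod p). -/
/-- `X ≡ Y (mod p^k)` for rational numbers: `X - Y`, written in lowest terms,
has numerator divisible by `p^k`. -/
def RatModEq (p k : ℕ) (X Y : ℚ) : Prop := (p : ℤ) ^ k ∣ (X - Y).num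

/-- The integer `k! * H_k`. -/
def factorialMulHarmonic : ℕ → ℕ
  | 0 => 0
  | k + 1 => (k + 1) * factorialMulHarmonic k + k.factorial

theorem factorialMulHarmonic_eq (k : ℕ) :
    (factorialMulHarmonic k : ℚ) = k.factorial * harmonic k := by
  induction k with
  | zero => simp [factorialMulHarmonic]
  | succ k ih =>
    have : (k : ℚ) + 1 ≠ 0 := by positivity
    rw [factorialMulHarmonic, harmonic_succ, Nat.factorial_succ]
    push_cast
    rw [ih]
    field_simp

/-- Divisibility of the numerator of a rational number can be tested after clearing denominators
prime to `p`. -/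
theorem dvd_num_iff_of_mul_eq {p : ℕ} (hp : p.Prime) {q : ℚ} {m z : ℤ}
    (hm : ¬ (p : ℤ) ∣ m) (h : q * m = z) : (p : ℤ) ∣ q.num ↔ (p : ℤ) ∣ z := by
  have hpz : Prime (p : ℤ) := Nat.prime_iff_prime_int.mp hp
  have key : q.num * m = z * q.den := by
    have hd : (q.den : ℚ) ≠ 0 := by exact_mod_cast q.den_nz
    have : (q.num : ℚ) * m = z * q.den := by
      rw [← h, ← Rat.mul_den_eq_num q]
      ring
    exact_mod_cast this
  constructor
  · intro hn
    have hz : (p : ℤ) ∣ z * q.den := key ▸ hn.mul_right m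
    refine (hpz.dvd_or_dvd hz).resolve_right fun hd => ?_
    have h1 : p ∣ q.num.natAbs := Int.natCast_dvd.mp hn
    have h2 : p ∣ q.den := by exact_mod_cast hd
    exact hp.not_dvd_one (q.reduced ▸ Nat.dvd_gcd h1 h2)
  · intro hz
    exact (hpz.dvd_or_dvd (key ▸ hz.mul_right _ : (p : ℤ) ∣ q.num * m)).resolve_right hm

theorem not_dvd_factorial_int {p k : ℕ} (hp : p.Prime) (hk : k < p) :
    ¬ (p : ℤ) ∣ (k.factorial : ℤ) := by
  rw [Int.natCast_dvd_natCast, hp.dvd_factorial]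
  omega

theorem ratModEq_harmonic_iff {p i j : ℕ} (hp : p.Prime) (hi : i < p) (hj : j < p) :
    RatModEq p 1 (harmonic i) (harmonic j) ↔
      (p : ℤ) ∣ j.factorial * factorialMulHarmonic i - i.factorial * factorialMulHarmonic j := by
  rw [RatModEq, pow_one]
  apply dvd_num_iff_of_mul_eq hp (m := (i.factorial * j.factorial : ℤ))
  · exact (Nat.prime_iff_prime_int.mp hp).not_dvd_mul (not_dvd_factorial_int hp hi)
      (not_dvd_factorial_int hp hj)
  · push_cast
    rw [factorialMulHarmonic_eq, factorialMulHarmonic_eq]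
    ring

theorem ascFactorial_mul_add_one_modEq (p n k : ℕ) :
    (p * n + 1).ascFactorial k ≡ k.factorial + p * n * factorialMulHarmonic k [MOD p ^ 2] := by
  induction k with
  | zero => simp [factorialMulHarmonic, Nat.ModEq]
  | succ k ih =>
    rw [Nat.ascFactorial_succ, factorialMulHarmonic, Nat.factorial_succ]
    refine (ih.mul_left _).trans ?_
    rw [← Int.natCast_modEq_iff]
    apply Int.ModEq.symm
    rw [Int.modEq_iff_dvd]
    refine ⟨n ^ 2 * factorialMulHarmonic k, ?_⟩
    push_cast
    ring

theorem dvd_choose_mul_of_not_dvd {p : ℕ} (hp : p.Prime) (a : ℕ) {i : ℕ} (hi : ¬ p ∣ i) :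
    p ∣ (p * a).choose i := by
  obtain _ | i := i
  · simp at hi
  obtain h | h := Nat.eq_zero_or_pos (p * a)
  · simp [h]
  · obtain ⟨m, hm⟩ := Nat.exists_eq_succ_of_ne_zero h.ne'
    have h1 := Nat.add_one_mul_choose_eq m i
    rw [← Nat.succ_eq_add_one m, ← hm] at h1
    have h2 : p ∣ (p * a).choose (i + 1) * (i + 1) := by
      rw [← h1, mul_assoc]
      exact dvd_mul_right _ _
    exact (hp.dvd_mul.mp h2).resolve_right hi

/-- Babbage's congruence. -/
theorem choose_mul_mul_modEq {p : ℕ} (hp : p.Prime) (a b : ℕ) :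
    (p * a).choose (p * b) ≡ a.choose b [MOD p ^ 2] := by
  induction a generalizing b with
  | zero =>
    obtain _ | b := b
    · simp [Nat.ModEq]
    · rw [mul_zero, Nat.choose_eq_zero_of_lt (Nat.mul_pos hp.pos b.succ_pos),
        Nat.choose_eq_zero_of_lt b.succ_pos]
  | succ a ih =>
    obtain _ | b := b
    · simp [Nat.ModEq]
    have hle : p ≤ p * (b + 1) := Nat.le_mul_of_pos_right p b.succ_pos
    have hvan : (p * (a + 1)).choose (p * (b + 1)) =
        ∑ j ∈ Finset.range (p * (b + 1) + 1), p.choose j * (p * a).choose (p * (b + 1) - j) := by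
      rw [mul_add_one p a, add_comm, Nat.add_choose_eq,
        Finset.Nat.sum_antidiagonal_eq_sum_range_succ_mk]
    have hsub : ({0, p} : Finset ℕ) ⊆ Finset.range (p * (b + 1) + 1) := by
      intro j
      simp only [Finset.mem_insert, Finset.mem_singleton, Finset.mem_range]
      omega
    rw [hvan, ← Finset.sum_sdiff hsub, Finset.sum_pair hp.ne_zero.symm]
    have hmid : p ^ 2 ∣ ∑ j ∈ Finset.range (p * (b + 1) + 1) \ {0, p},
        p.choose j * (p * a).choose (p * (b + 1) - j) := by
      refine Finset.dvd_sum fun j hj => ?_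
      simp only [Finset.mem_sdiff, Finset.mem_insert, Finset.mem_singleton, Finset.mem_range,
        not_or] at hj
      obtain ⟨hj, hj0, hjp⟩ := hj
      obtain hlt | hgt := Nat.lt_or_gt_of_ne hjp
      · rw [pow_two]
        refine mul_dvd_mul (hp.dvd_choose_self hj0 hlt) (dvd_choose_mul_of_not_dvd hp a ?_)
        rw [Nat.dvd_sub_iff_right (by omega) (dvd_mul_right _ _)]
        exact Nat.not_dvd_of_pos_of_lt (Nat.pos_of_ne_zero hj0) hlt
      · simp [Nat.choose_eq_zero_of_lt hgt]
    have hsubp : p * (b + 1) - p = p * b := by rw [mul_add_one, Nat.add_sub_cancel]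
    have h := (Nat.modEq_zero_iff_dvd.mpr hmid).add ((ih (b + 1)).add (ih b))
    rw [Nat.choose_zero_right, Nat.choose_self, one_mul, one_mul, Nat.sub_zero, hsubp,
      Nat.choose_succ_succ]
    refine h.trans ?_
    rw [zero_add, add_comm]

theorem choose_add_left_mul_factorial_mul_factorial (i j : ℕ) :
    (i + j).choose i * i.factorial * j.factorial = (i + j).factorial := by
  rw [Nat.choose_symm_add, Nat.add_choose_mul_factorial_mul_factorial]

theorem choose_mul_ascFactorial_mul_ascFactorial (p b c s t : ℕ) :
    (p * (b + c) + (s + t)).choose (p * b + s) *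
        ((p * b + 1).ascFactorial s * (p * c + 1).ascFactorial t) =
      (p * (b + c)).choose (p * b) * (p * (b + c) + 1).ascFactorial (s + t) := by
  have h1 := choose_add_left_mul_factorial_mul_factorial (p * b + s) (p * c + t)
  have h2 := choose_add_left_mul_factorial_mul_factorial (p * b) (p * c)
  have e1 : p * b + s + (p * c + t) = p * (b + c) + (s + t) := by ring
  rw [e1, ← Nat.factorial_mul_ascFactorial (p * b), ← Nat.factorial_mul_ascFactorial (p * c),
    ← Nat.factorial_mul_ascFactorial (p * (b + c))] at h1
  rw [← mul_add] at h2
  have hpos : 0 < (p * b).factorial * (p * c).factorial := by positivity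
  apply Nat.eq_of_mul_eq_mul_right hpos
  rw [← h2] at h1
  linarith

theorem choose_modEq_sq_iff {p : ℕ} (hp : p.Prime) (b c s t : ℕ) (hst : s + t < p) :
    (p * (b + c) + (s + t)).choose (p * b + s) ≡
        (b + c).choose b * (s + t).choose s [MOD p ^ 2] ↔
      (p : ℤ) ∣ (b + c).choose b * ((s + t).choose s *
        (b * factorialMulHarmonic s * t.factorial + c * factorialMulHarmonic t * s.factorial) -
          (b + c) * factorialMulHarmonic (s + t)) := by
  have hpz : Prime (p : ℤ) := Nat.prime_iff_prime_int.mp hp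
  set X := (p * (b + c) + (s + t)).choose (p * b + s)
  set A := (p * b + 1).ascFactorial s * (p * c + 1).ascFactorial t
  have hAmod : A ≡ (s.factorial + p * b * factorialMulHarmonic s) *
      (t.factorial + p * c * factorialMulHarmonic t) [MOD p ^ 2] :=
    (ascFactorial_mul_add_one_modEq p b s).mul (ascFactorial_mul_add_one_modEq p c t)
  have hXA : X * A ≡ (b + c).choose b *
      ((s + t).factorial + p * (b + c) * factorialMulHarmonic (s + t)) [MOD p ^ 2] := by
    rw [choose_mul_ascFactorial_mul_ascFactorial]
    exact (choose_mul_mul_modEq hp _ _).mul (ascFactorial_mul_add_one_modEq p _ _)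
  have hcop : Nat.Coprime (p ^ 2) A := by
    apply Nat.Coprime.pow_left
    rw [hp.coprime_iff_not_dvd, ← Int.natCast_dvd_natCast]
    intro hdvd
    have h1 : (p : ℤ) ∣ s.factorial * t.factorial := by
      have h := Nat.modEq_iff_dvd.mp hAmod
      have h' : (p : ℤ) ∣ ((p ^ 2 : ℕ) : ℤ) := by exact_mod_cast dvd_pow_self p two_ne_zero
      have h2 := (dvd_sub_left hdvd).mp (h'.trans h)
      push_cast at h2
      have h3 : (p : ℤ) ∣ p * (b * factorialMulHarmonic s * t.factorial +
          c * factorialMulHarmonic t * s.factorial +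
          p * b * c * factorialMulHarmonic s * factorialMulHarmonic t) := dvd_mul_right _ _
      refine (dvd_sub h2 h3).trans (dvd_of_eq ?_)
      ring
    exact hpz.not_dvd_mul (not_dvd_factorial_int hp (by omega))
      (not_dvd_factorial_int hp (by omega)) h1
  have hcancel : X ≡ (b + c).choose b * (s + t).choose s [MOD p ^ 2] ↔
      X * A ≡ (b + c).choose b * (s + t).choose s * A [MOD p ^ 2] :=
    ⟨fun h => h.mul_right A, fun h => Nat.ModEq.cancel_right_of_coprime hcop h⟩
  have hfac : ((s + t).choose s * s.factorial * t.factorial : ℤ) = (s + t).factorial := by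
    exact_mod_cast choose_add_left_mul_factorial_mul_factorial s t
  have hiff : X * A ≡ (b + c).choose b * (s + t).choose s * A [MOD p ^ 2] ↔
      (b + c).choose b * ((s + t).factorial + p * (b + c) * factorialMulHarmonic (s + t)) ≡
        (b + c).choose b * (s + t).choose s * ((s.factorial + p * b * factorialMulHarmonic s) *
          (t.factorial + p * c * factorialMulHarmonic t)) [MOD p ^ 2] :=
    ⟨fun h => hXA.symm.trans (h.trans (hAmod.mul_left _)),
      fun h => hXA.trans (h.trans (hAmod.mul_left _).symm)⟩
  rw [hcancel, hiff, Nat.modEq_iff_dvd]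
  push_cast
  rw [← hfac]
  have hp0 : (p : ℤ) ≠ 0 := hpz.ne_zero
  rw [← mul_dvd_mul_iff_left (b := (p : ℤ)) hp0, ← pow_two]
  refine Iff.trans ?_ (dvd_add_left (dvd_mul_right ((p : ℤ) ^ 2)
    ((b + c).choose b * (s + t).choose s * b * c * factorialMulHarmonic s *
      factorialMulHarmonic t)))
  apply iff_of_eq
  congr 1
  ring

/-- For 0 ≤ s ≤ r ≤ p-1, the Lucas congruence modulo p² holds for the
pair (r, s) for all a, b ≥ 0 if and only if H_r ≡ H_{r-s} ≡ H_s (mod p). -/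
theorem lucas_mod_p_sq_iff_harmonic (p : ℕ) (hp : p.Prime) (r s : ℕ) (hsr : s ≤ r)
    (hr : r ≤ p - 1) :
    (∀ a b : ℕ, (p * a + r).choose (p * b + s) ≡ a.choose b * r.choose s [MOD p ^ 2]) ↔
      (RatModEq p 1 (harmonic r) (harmonic (r - s)) ∧
        RatModEq p 1 (harmonic (r - s)) (harmonic s)) := by
  have hpz : Prime (p : ℤ) := Nat.prime_iff_prime_int.mp hp
  have hrp : r < p := by have := hp.pos; omega
  obtain ⟨t, rfl⟩ := Nat.exists_eq_add_of_le hsr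
  rw [Nat.add_sub_cancel_left, ratModEq_harmonic_iff hp hrp (by omega),
    ratModEq_harmonic_iff hp (by omega) (by omega)]
  have hfac : ((s + t).choose s * s.factorial * t.factorial : ℤ) = (s + t).factorial := by
    exact_mod_cast choose_add_left_mul_factorial_mul_factorial s t
  have hs := not_dvd_factorial_int hp (show s < p by omega)
  have ht := not_dvd_factorial_int hp (show t < p by omega)
  have hst := not_dvd_factorial_int hp hrp
  constructor
  · intro h
    have h0 := (choose_modEq_sq_iff hp 0 1 s t hrp).mp (h _ _)
    have h1 := (choose_modEq_sq_iff hp 1 0 s t hrp).mp (h _ _)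
    simp only [Nat.cast_zero, Nat.cast_one, zero_mul, one_mul, zero_add, add_zero,
      Nat.choose_zero_right, Nat.choose_self] at h0 h1
    have h0' : (p : ℤ) ∣ t.factorial * factorialMulHarmonic (s + t) -
        (s + t).factorial * factorialMulHarmonic t := by
      rw [← hfac]
      refine (h0.mul_left (-(t.factorial : ℤ))).trans (dvd_of_eq ?_)
      ring
    refine ⟨h0', (hpz.dvd_or_dvd ?_).resolve_left hst⟩
    have h1' := h1.mul_left (-(s.factorial * t.factorial : ℤ))
    refine (dvd_sub h1' (h0'.mul_left s.factorial)).trans (dvd_of_eq ?_)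
    rw [← hfac]
    ring
  · rintro ⟨h1, h2⟩ a b
    obtain hab | hba := Nat.lt_or_ge a b
    · have : p * (a + 1) ≤ p * b := Nat.mul_le_mul_left p hab
      rw [Nat.choose_eq_zero_of_lt hab, Nat.choose_eq_zero_of_lt (by linarith), zero_mul]
    · obtain ⟨c, rfl⟩ := Nat.exists_eq_add_of_le hba
      refine (choose_modEq_sq_iff hp b c s t hrp).mpr (Dvd.dvd.mul_left ?_ _)
      refine (hpz.dvd_or_dvd ?_).resolve_left (hpz.not_dvd_mul hs ht)
      refine (dvd_sub (h1.mul_left (-(s.factorial * (b + c) : ℤ)))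
        (h2.mul_left ((s + t).factorial * b : ℤ))).trans (dvd_of_eq ?_)
      rw [← hfac]
      ring
end

section
/- Let p be an odd prime. Then 2^{p-1} ≡ 1 (mod p²) if and only if each of the three pairs (r,s) = ((p-1)/2, 0), (r,s) = ((p-1)/2, (p-1)/2), and (r,s) = (p-1, (p-1)/2) satisfies the congruence C(p·a + r, p·b + s) ≡ C(a,b)·C(r,s) (mod p²) for all integers a ≥ 0 and b ≥ 0. -/
/-- The product `(x + 1) (x + 2) ⋯ (x + n)`. -/
def shiftedFactorial {R : Type*} [CommRing R] (x : R) (n : ℕ) : R :=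
  ∏ i ∈ Finset.range n, (x + (i + 1))

section CommRing

variable {R : Type*} [CommRing R]

theorem shiftedFactorial_zero_left (n : ℕ) : shiftedFactorial (0 : R) n = (n.factorial : R) := by
  simp [shiftedFactorial, ← Finset.prod_range_add_one_eq_factorial]

theorem natCast_ascFactorial_succ (m n : ℕ) :
    (((m + 1).ascFactorial n : ℕ) : R) = shiftedFactorial (m : R) n := by
  rw [Nat.ascFactorial_eq_prod_range, shiftedFactorial, Nat.cast_prod]
  refine Finset.prod_congr rfl fun i _ => ?_
  push_cast
  ring

theorem exists_shiftedFactorial_eq_add {c : R} (hc : c ^ 2 = 0) (n : ℕ) :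
    ∃ e : R, ∀ t : R, shiftedFactorial (c * t) n = (n.factorial : R) + t * (c * e) := by
  induction n with
  | zero => exact ⟨0, fun t => by simp [shiftedFactorial]⟩
  | succ n ih =>
    obtain ⟨e, he⟩ := ih
    refine ⟨n.factorial + (n + 1) * e, fun t => ?_⟩
    have h := he t
    rw [shiftedFactorial] at h ⊢
    rw [Finset.prod_range_succ, h, Nat.factorial_succ]
    push_cast
    linear_combination t ^ 2 * e * hc

theorem shiftedFactorial_two_mul (x : R) (n : ℕ) :
    shiftedFactorial x (2 * n) =
      (-1) ^ n * shiftedFactorial x n * shiftedFactorial (-(x + ((2 * n + 1 : ℕ) : R))) n := by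
  have h : ∏ i ∈ Finset.range n, (x + (((n + i : ℕ) : R) + 1)) =
      (-1) ^ n * shiftedFactorial (-(x + ((2 * n + 1 : ℕ) : R))) n := by
    rw [shiftedFactorial, ← Finset.prod_range_reflect]
    have hpow : (-1 : R) ^ n = ∏ _i ∈ Finset.range n, (-1 : R) := by simp
    rw [hpow, ← Finset.prod_mul_distrib]
    refine Finset.prod_congr rfl fun i hi => ?_
    obtain ⟨k, rfl⟩ := Nat.exists_eq_add_of_lt (Finset.mem_range.mp hi)
    rw [show i + k + 1 - 1 - i = k by omega]
    push_cast
    ring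
  rw [mul_right_comm, ← h, shiftedFactorial, shiftedFactorial, two_mul, Finset.prod_range_add,
    mul_comm]

theorem factorial_two_mul_eq_shiftedFactorial {h : R} (hh : 2 * h = 1) (n : ℕ) :
    ((2 * n).factorial : R) = 2 ^ n * n.factorial *
      ((-2) ^ n * shiftedFactorial (((2 * n + 1 : ℕ) : R) * -h) n) := by
  have h₁ : ((2 * n).factorial : R) =
      2 ^ n * n.factorial * ∏ i ∈ Finset.range n, (2 * (i : R) + 1) := by
    induction n with
    | zero => simp
    | succ n ih =>
      rw [Finset.prod_range_succ, show 2 * (n + 1) = 2 * n + 1 + 1 by ring, Nat.factorial_succ,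
        Nat.factorial_succ, Nat.factorial_succ]
      push_cast
      rw [ih]
      ring
  rw [h₁, shiftedFactorial, ← Finset.prod_range_reflect]
  have hpow : (-2 : R) ^ n = ∏ _i ∈ Finset.range n, (-2 : R) := by simp
  rw [hpow, ← Finset.prod_mul_distrib]
  congr 1
  refine Finset.prod_congr rfl fun i hi => ?_
  obtain ⟨k, rfl⟩ := Nat.exists_eq_add_of_lt (Finset.mem_range.mp hi)
  rw [show i + k + 1 - 1 - i = k by omega]
  push_cast
  linear_combination -(2 * (i + k + 1 : R) + 1) * hh

/-- If `2 * n + 1` squares to zero, `(x + 1) ⋯ (x + 2 * n)` takes the same value at all its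
multiples `x`. -/
theorem shiftedFactorial_two_mul_eq_factorial {n : ℕ} (hc : ((2 * n + 1 : ℕ) : R) ^ 2 = 0)
    (t : R) :
    shiftedFactorial (((2 * n + 1 : ℕ) : R) * t) (2 * n) = ((2 * n).factorial : R) := by
  obtain ⟨e, he⟩ := exists_shiftedFactorial_eq_add hc n
  have key (s : R) : shiftedFactorial (((2 * n + 1 : ℕ) : R) * s) (2 * n) =
      (-1) ^ n * ((n.factorial : R) + s * (((2 * n + 1 : ℕ) : R) * e)) *
        (n.factorial + (-(s + 1)) * (((2 * n + 1 : ℕ) : R) * e)) := by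
    rw [shiftedFactorial_two_mul, he, ← he (-(s + 1))]
    congr 2
    ring
  rw [← shiftedFactorial_zero_left, ← mul_zero ((2 * n + 1 : ℕ) : R), key, key]
  linear_combination (-1) ^ n * (-(t * (t + 1)) * e ^ 2) * hc

theorem two_pow_eq_one_iff_shiftedFactorial {n : ℕ} (hc : ((2 * n + 1 : ℕ) : R) ^ 2 = 0)
    (h2 : IsUnit (2 : R)) (hn : IsUnit (n.factorial : R)) :
    (2 : R) ^ (2 * n) = 1 ↔
      ∀ t : R, shiftedFactorial (((2 * n + 1 : ℕ) : R) * t) n = n.factorial := by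
  obtain ⟨h, hh⟩ := h2.exists_right_inv
  obtain ⟨e, he⟩ := exists_shiftedFactorial_eq_add hc n
  have h₁ := factorial_two_mul_eq_shiftedFactorial hh n
  have h₂ := shiftedFactorial_two_mul (0 : R) n
  rw [shiftedFactorial_zero_left, shiftedFactorial_zero_left, zero_add, h₁,
    ← mul_neg_one ((2 * n + 1 : ℕ) : R), he, he] at h₂
  have hs : ((-1 : R) ^ n) * (-1) ^ n = 1 := by rw [← mul_pow]; simp
  have key : (2 : R) ^ (2 * n) * (n.factorial + -h * (((2 * n + 1 : ℕ) : R) * e)) =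
      n.factorial + -1 * (((2 * n + 1 : ℕ) : R) * e) := by
    apply hn.mul_left_cancel
    rw [neg_pow (2 : R) n] at h₂
    rw [show (2 : R) ^ (2 * n) = 2 ^ n * 2 ^ n by rw [two_mul, pow_add]]
    linear_combination (-1) ^ n * h₂ + (n.factorial : R) * (n.factorial + -1 * (((2 * n + 1 : ℕ) : R) * e) -
      2 ^ n * 2 ^ n * (n.factorial + -h * (((2 * n + 1 : ℕ) : R) * e))) * hs
  simp only [he]
  constructor
  · intro hw t
    rw [hw] at key
    linear_combination t * (2 * key + (((2 * n + 1 : ℕ) : R) * e) * hh)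
  · intro hw
    have hz := hw 1
    have hz' : (((2 * n + 1 : ℕ) : R) * e) = 0 := by linear_combination hz
    rw [hz'] at key
    apply hn.mul_right_cancel
    linear_combination key

end CommRing

/-- The factors of `(p * a)!` coprime to a prime `p` can be grouped into `a` blocks. -/
theorem factorial_succ_mul (m a : ℕ) :
    ((m + 1) * a).factorial =
      (m + 1) ^ a * a.factorial * ∏ j ∈ Finset.range a, ((m + 1) * j + 1).ascFactorial m := by
  induction a with
  | zero => simp
  | succ a ih =>
    rw [Finset.prod_range_succ, show (m + 1) * (a + 1) = (m + 1) * a + m + 1 by ring,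
      Nat.factorial_succ, ← Nat.factorial_mul_ascFactorial, ih, Nat.factorial_succ]
    ring

theorem choose_mul_mul_prod_ascFactorial (m b d : ℕ) :
    ((m + 1) * (b + d)).choose ((m + 1) * b) *
        ((∏ j ∈ Finset.range b, ((m + 1) * j + 1).ascFactorial m) *
          ∏ j ∈ Finset.range d, ((m + 1) * j + 1).ascFactorial m) =
      (b + d).choose b * ∏ j ∈ Finset.range (b + d), ((m + 1) * j + 1).ascFactorial m := by
  have h₁ := Nat.add_choose_mul_factorial_mul_factorial ((m + 1) * b) ((m + 1) * d)
  have h₂ := Nat.add_choose_mul_factorial_mul_factorial b d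
  rw [← Nat.choose_symm_add] at h₁ h₂
  rw [← mul_add, factorial_succ_mul, factorial_succ_mul, factorial_succ_mul, ← h₂] at h₁
  have h₃ : 0 < (m + 1) ^ (b + d) * (b.factorial * d.factorial) := by positivity
  apply Nat.eq_of_mul_eq_mul_left h₃
  rw [pow_add] at h₁ ⊢
  linarith

theorem add_choose_mul_ascFactorial (x y s t : ℕ) :
    (x + y + (s + t)).choose (x + s) * ((x + 1).ascFactorial s * (y + 1).ascFactorial t) =
      (x + y).choose x * (x + y + 1).ascFactorial (s + t) := by
  have h₁ := Nat.add_choose_mul_factorial_mul_factorial (x + s) (y + t)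
  have h₂ := Nat.add_choose_mul_factorial_mul_factorial x y
  rw [← Nat.choose_symm_add] at h₁ h₂
  rw [show x + s + (y + t) = x + y + (s + t) by ring, ← Nat.factorial_mul_ascFactorial,
    ← Nat.factorial_mul_ascFactorial, ← Nat.factorial_mul_ascFactorial, ← h₂] at h₁
  have h₃ : 0 < x.factorial * y.factorial := by positivity
  apply Nat.eq_of_mul_eq_mul_left h₃
  linarith

section CommRing

variable {R : Type*} [CommRing R]

/-- If `2 * n + 1` squares to zero and `(2 * n)!` is invertible, then multiplying both entries of
a binomial coefficient by `2 * n + 1` does not change it. -/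
theorem natCast_choose_mul_mul {n : ℕ} (hc : ((2 * n + 1 : ℕ) : R) ^ 2 = 0)
    (hu : IsUnit ((2 * n).factorial : R)) (b d : ℕ) :
    ((((2 * n + 1) * (b + d)).choose ((2 * n + 1) * b) : ℕ) : R) = ((b + d).choose b : ℕ) := by
  have h := congrArg (Nat.cast : ℕ → R) (choose_mul_mul_prod_ascFactorial (2 * n) b d)
  have hw (j : ℕ) : ((((2 * n + 1) * j + 1).ascFactorial (2 * n) : ℕ) : R) =
      (2 * n).factorial := by
    rw [natCast_ascFactorial_succ, Nat.cast_mul, shiftedFactorial_two_mul_eq_factorial hc]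
  rw [Nat.cast_mul, Nat.cast_mul, Nat.cast_mul, Nat.cast_prod, Nat.cast_prod, Nat.cast_prod] at h
  simp only [hw, Finset.prod_const, Finset.card_range] at h
  rw [← pow_add] at h
  exact (hu.pow _).mul_right_cancel h

/-- The Lucas congruence for `(s + t, s)`, given that the products of `s`, `t` and `s + t`
consecutive integers following a multiple of `2 * n + 1` are factorials. -/
theorem natCast_choose_mul_add {n s t : ℕ} (hc : ((2 * n + 1 : ℕ) : R) ^ 2 = 0)
    (hu : IsUnit ((2 * n).factorial : R))
    (hs : IsUnit (s.factorial : R)) (ht : IsUnit (t.factorial : R)) (hst : s + t < 2 * n + 1)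
    (h₁ : ∀ x : R, shiftedFactorial (((2 * n + 1 : ℕ) : R) * x) s = s.factorial)
    (h₂ : ∀ x : R, shiftedFactorial (((2 * n + 1 : ℕ) : R) * x) t = t.factorial)
    (h₃ : ∀ x : R, shiftedFactorial (((2 * n + 1 : ℕ) : R) * x) (s + t) = (s + t).factorial)
    (a b : ℕ) :
    ((((2 * n + 1) * a + (s + t)).choose ((2 * n + 1) * b + s) : ℕ) : R) =
      ((a.choose b * (s + t).choose s : ℕ) : R) := by
  rcases le_or_gt b a with hab | hab
  · obtain ⟨d, rfl⟩ := Nat.exists_eq_add_of_le hab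
    have h := congrArg (Nat.cast : ℕ → R)
      (add_choose_mul_ascFactorial ((2 * n + 1) * b) ((2 * n + 1) * d) s t)
    rw [← mul_add] at h
    simp only [Nat.cast_mul (Nat.choose _ _), Nat.cast_mul (Nat.ascFactorial _ _),
      natCast_ascFactorial_succ] at h
    simp only [Nat.cast_mul (2 * n + 1), h₁, h₂, h₃, natCast_choose_mul_mul hc hu] at h
    apply (hs.mul ht).mul_right_cancel
    rw [h, ← Nat.add_choose_mul_factorial_mul_factorial s t, ← Nat.choose_symm_add]
    push_cast
    ring
  · have : (2 * n + 1) * (a + 1) ≤ (2 * n + 1) * b := Nat.mul_le_mul_left _ hab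
    rw [Nat.choose_eq_zero_of_lt (by linarith), Nat.choose_eq_zero_of_lt hab, zero_mul]

end CommRing

/-- For an odd prime p, 2^(p-1) ≡ 1 (mod p²) if and only if the Lucas
congruence modulo p² holds for each of the three pairs ((p-1)/2, 0),
((p-1)/2, (p-1)/2), and (p-1, (p-1)/2), for all a, b ≥ 0. -/
theorem wieferich_iff_three_midpoints (p : ℕ) (hp : p.Prime) (hodd : Odd p) :
    2 ^ (p - 1) ≡ 1 [MOD p ^ 2] ↔
      ((∀ a b : ℕ, (p * a + (p - 1) / 2).choose (p * b + 0) ≡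
          a.choose b * ((p - 1) / 2).choose 0 [MOD p ^ 2]) ∧
        (∀ a b : ℕ, (p * a + (p - 1) / 2).choose (p * b + (p - 1) / 2) ≡
          a.choose b * ((p - 1) / 2).choose ((p - 1) / 2) [MOD p ^ 2]) ∧
        (∀ a b : ℕ, (p * a + (p - 1)).choose (p * b + (p - 1) / 2) ≡
          a.choose b * (p - 1).choose ((p - 1) / 2) [MOD p ^ 2])) := by
  obtain ⟨n, rfl⟩ := hodd
  have hunit (k : ℕ) (hk : k < 2 * n + 1) : IsUnit (k.factorial : ZMod ((2 * n + 1) ^ 2)) := by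
    rw [ZMod.isUnit_iff_coprime]
    exact ((hp.coprime_factorial_of_lt hk).symm.pow_right 2)
  have hc : ((2 * n + 1 : ℕ) : ZMod ((2 * n + 1) ^ 2)) ^ 2 = 0 := by
    rw [← Nat.cast_pow, ZMod.natCast_self]
  have hn : 1 ≤ n := by have := hp.two_le; omega
  have h2 : IsUnit (2 : ZMod ((2 * n + 1) ^ 2)) := by
    simpa using hunit 2 (by omega)
  rw [show 2 * n + 1 - 1 = 2 * n by omega, show 2 * n / 2 = n by omega]
  simp only [← ZMod.natCast_eq_natCast_iff]
  rw [Nat.cast_pow, Nat.cast_one, Nat.cast_ofNat,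
    two_pow_eq_one_iff_shiftedFactorial hc h2 (hunit n (by omega))]
  constructor
  · intro h
    have h₀ (x : ZMod ((2 * n + 1) ^ 2)) :
        shiftedFactorial (((2 * n + 1 : ℕ) : ZMod ((2 * n + 1) ^ 2)) * x) 0 =
          ((Nat.factorial 0 : ℕ) : ZMod ((2 * n + 1) ^ 2)) := by
      simp [shiftedFactorial]
    have hu := hunit (2 * n) (by omega)
    have hun := hunit n (by omega)
    have hu₀ := hunit 0 (by omega)
    refine ⟨fun a b => ?_, fun a b => ?_, fun a b => ?_⟩
    · simpa only [zero_add] using natCast_choose_mul_add hc hu hu₀ hun (by omega) h₀ h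
        (by simpa only [zero_add] using h) a b
    · exact natCast_choose_mul_add hc hu hun hu₀ (by omega) h h₀ h a b
    · have := natCast_choose_mul_add hc hu hun hun (by omega) h h
        (by simpa only [← two_mul] using shiftedFactorial_two_mul_eq_factorial hc) a b
      simpa only [← two_mul] using this
  · rintro ⟨h, -, -⟩ t
    obtain ⟨e, he⟩ := exists_shiftedFactorial_eq_add hc n
    have h₁ := congrArg (Nat.cast : ℕ → ZMod ((2 * n + 1) ^ 2))
      (add_choose_mul_ascFactorial (2 * n + 1) 0 0 n)
    have h₂ := h 1 1
    simp only [mul_one, add_zero, zero_add, Nat.choose_self, Nat.choose_zero_right, one_mul,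
      Nat.ascFactorial_zero, Nat.one_ascFactorial] at h₁ h₂
    rw [Nat.cast_mul, h₂, natCast_ascFactorial_succ, ← mul_one ((2 * n + 1 : ℕ) : ZMod ((2 * n + 1) ^ 2)),
      he] at h₁
    rw [he]
    push_cast at h₁ ⊢
    linear_combination -t * h₁
end
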